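/- arXiv:2111.00092 — 5 statements merged into one kernel-verified Lean document; each statement's English description precedes it below -/
import Mathlib

section
/- Let (p_1,…,p_d) be a probability vector and let X be a random one-hot vector in {0,1}^d with P(X = e_i) = p_i; run MMRC simulating Subset Selection on X with N candidates. Then for each coordinate i: P((Z_K)_i = 1) = p_i·m_mmrc + b_mmrc. -/
open scoped Classical
open Real Finset

noncomputable section

/-- The output alphabet of Subset Selection: subsets of `[d]` of size `s`. -/
def zset (d s : ℕ) : Finset (Finset (Fin d)) := Finset.powersetCard s Finset.univ

/-- Normalizing constant of the Subset Selection pmf. -/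
def qssC (d s : ℕ) (ε : ℝ) : ℝ :=
  ((d - 1).choose (s - 1) : ℝ) * Real.exp ε + ((d - 1).choose s : ℝ)

/-- The Subset Selection pmf `q^ss(A | e_j)`. -/
def qss (d s : ℕ) (ε : ℝ) (j : Fin d) (A : Finset (Fin d)) : ℝ :=
  if j ∈ A then Real.exp ε / qssC d s ε else 1 / qssC d s ε

/-- Subset Selection scaling factor `m_ss`. -/
def mss (d s : ℕ) (ε : ℝ) : ℝ :=
  (s : ℝ) * ((d : ℝ) - (s : ℝ)) * (Real.exp ε - 1) /
    (((d : ℝ) - 1) * ((s : ℝ) * (Real.exp ε - 1) + (d : ℝ)))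

/-- Subset Selection offset `b_ss`. -/
def bss (d s : ℕ) (ε : ℝ) : ℝ :=
  (s : ℝ) * (((s : ℝ) - 1) * Real.exp ε + ((d : ℝ) - (s : ℝ))) /
    (((d : ℝ) - 1) * ((s : ℝ) * (Real.exp ε - 1) + (d : ℝ)))

/-- The Subset Selection estimator `x̂^ss = (z − b_ss·𝟙)/m_ss`, coordinate `i`. -/
def xhatSS (d s : ℕ) (ε : ℝ) (A : Finset (Fin d)) (i : Fin d) : ℝ :=
  ((if i ∈ A then (1 : ℝ) else 0) - bss d s ε) / mss d s ε

/-- Expectation of `f(M/N)` for `M ~ Binomial(N, μ)`. -/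
def binomExp (N : ℕ) (μ : ℝ) (f : ℝ → ℝ) : ℝ :=
  ∑ M ∈ Finset.range (N + 1),
    (N.choose M : ℝ) * μ ^ M * (1 - μ) ^ (N - M) * f ((M : ℝ) / (N : ℝ))

/-- The in-cap selection probability of MRC given in-cap fraction `θ`. -/
def hMrc (ε θ : ℝ) : ℝ := Real.exp ε * θ / (Real.exp ε * θ + (1 - θ))

/-- MRC-simulating-Subset-Selection offset `b_mrc`. -/
def bMrcSS (d s N : ℕ) (ε : ℝ) : ℝ :=
  (1 / ((d : ℝ) - 1)) * binomExp N ((s : ℝ) / (d : ℝ)) (fun θ => (s : ℝ) - hMrc ε θ)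

/-- MRC-simulating-Subset-Selection scaling factor `m_mrc`. -/
def mMrcSS (d s N : ℕ) (ε : ℝ) : ℝ :=
  binomExp N ((s : ℝ) / (d : ℝ)) (hMrc ε) - bMrcSS d s N ε

/-- The MRC index distribution simulating Subset Selection:
`P(K = k) ∝ e^ε` for in-cap candidates and `∝ 1` for out-cap candidates. -/
def piMrcSS (d N : ℕ) (ε : ℝ) (j : Fin d) (zs : Fin N → Finset (Fin d)) (k : Fin N) : ℝ :=
  (if j ∈ zs k then Real.exp ε else 1) /
    ∑ k' : Fin N, (if j ∈ zs k' then Real.exp ε else 1)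

/-- Marginal output distribution of MRC simulating Subset Selection over
i.i.d. uniform candidates and the selected index. -/
def qMrcOut (d s N : ℕ) (ε : ℝ) (j : Fin d) (A : Finset (Fin d)) : ℝ :=
  ∑ zs ∈ Fintype.piFinset (fun _ : Fin N => zset d s),
    (1 / ((zset d s).card : ℝ)) ^ N *
      ∑ k : Fin N, if zs k = A then piMrcSS d N ε j zs k else 0

/-- The debiased MRC estimator `x̂^mrc = (Z_K − b_mrc·𝟙)/m_mrc`, coordinate `i`. -/
def xhatMrc (d s N : ℕ) (ε : ℝ) (A : Finset (Fin d)) (i : Fin d) : ℝ :=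
  ((if i ∈ A then (1 : ℝ) else 0) - bMrcSS d s N ε) / mMrcSS d s N ε

/-- The MMRC index distribution simulating Subset Selection (with `μ = s/d` and
`a = e^ε·μ + (1−μ)`). -/
def piMmrcSS (d s N : ℕ) (ε : ℝ) (j : Fin d) (zs : Fin N → Finset (Fin d)) (k : Fin N) : ℝ :=
  let θ : ℝ := ((Finset.univ.filter fun i : Fin N => j ∈ zs i).card : ℝ) / (N : ℝ)
  let μ : ℝ := (s : ℝ) / (d : ℝ)
  let a : ℝ := Real.exp ε * μ + (1 - μ)
  if θ < μ then
    (if j ∈ zs k then Real.exp ε / ((N : ℝ) * a)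
     else (1 - θ * Real.exp ε / a) / ((N : ℝ) * (1 - θ)))
  else if μ < θ then
    (if j ∈ zs k then (1 - (1 - θ) / a) / ((N : ℝ) * θ) else 1 / ((N : ℝ) * a))
  else
    (if j ∈ zs k then Real.exp ε / ((N : ℝ) * (Real.exp ε * θ + (1 - θ)))
     else 1 / ((N : ℝ) * (Real.exp ε * θ + (1 - θ))))

/-- `g(θ) = (e^ε θ/a)·1{θ≤μ} + ((e^ε μ + θ − μ)/a)·1{θ>μ}`. -/
def gMmrc (ε μ θ : ℝ) : ℝ :=
  if θ ≤ μ then Real.exp ε * θ / (Real.exp ε * μ + (1 - μ))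
  else (Real.exp ε * μ + θ - μ) / (Real.exp ε * μ + (1 - μ))

/-- `E[g(θ)]` over `N·θ ~ Binomial(N, s/d)`. -/
def egMmrc (d s N : ℕ) (ε : ℝ) : ℝ :=
  binomExp N ((s : ℝ) / (d : ℝ)) (gMmrc ε ((s : ℝ) / (d : ℝ)))

/-- MMRC-simulating-Subset-Selection scaling factor `m_mmrc`. -/
def mMmrcSS (d s N : ℕ) (ε : ℝ) : ℝ :=
  ((d : ℝ) / ((d : ℝ) - 1)) * egMmrc d s N ε - (s : ℝ) / ((d : ℝ) - 1)

/-- MMRC-simulating-Subset-Selection offset `b_mmrc`. -/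
def bMmrcSS (d s N : ℕ) (ε : ℝ) : ℝ :=
  (1 / ((d : ℝ) - 1)) * ((s : ℝ) - egMmrc d s N ε)

/-- Marginal output distribution of MMRC simulating Subset Selection over
i.i.d. uniform candidates and the selected index. -/
def qMmrcOut (d s N : ℕ) (ε : ℝ) (j : Fin d) (A : Finset (Fin d)) : ℝ :=
  ∑ zs ∈ Fintype.piFinset (fun _ : Fin N => zset d s),
    (1 / ((zset d s).card : ℝ)) ^ N *
      ∑ k : Fin N, if zs k = A then piMmrcSS d s N ε j zs k else 0

/-- The debiased MMRC estimator `x̂^mmrc = (Z_K − b_mmrc·𝟙)/m_mmrc`, coordinate `i`. -/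
def xhatMmrc (d s N : ℕ) (ε : ℝ) (A : Finset (Fin d)) (i : Fin d) : ℝ :=
  ((if i ∈ A then (1 : ℝ) else 0) - bMmrcSS d s N ε) / mMmrcSS d s N ε

/-- Per-user expected squared error of Subset Selection on one-hot input `e_j`. -/
def errSSone (d s : ℕ) (ε : ℝ) (j : Fin d) : ℝ :=
  ∑ A ∈ zset d s, qss d s ε j A *
    ∑ i : Fin d, (xhatSS d s ε A i - (if i = j then (1 : ℝ) else 0)) ^ 2

/-- Per-user expected squared error of MRC simulating Subset Selection on input `e_j`. -/
def errMrcOne (d s N : ℕ) (ε : ℝ) (j : Fin d) : ℝ :=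
  ∑ A ∈ zset d s, qMrcOut d s N ε j A *
    ∑ i : Fin d, (xhatMrc d s N ε A i - (if i = j then (1 : ℝ) else 0)) ^ 2

/-- Per-user expected squared error of MMRC simulating Subset Selection on input `e_j`. -/
def errMmrcOne (d s N : ℕ) (ε : ℝ) (j : Fin d) : ℝ :=
  ∑ A ∈ zset d s, qMmrcOut d s N ε j A *
    ∑ i : Fin d, (xhatMmrc d s N ε A i - (if i = j then (1 : ℝ) else 0)) ^ 2

/-- `n`-user frequency-estimation squared error of Subset Selection on inputs
`e_{xs 1}, …, e_{xs n}`. -/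
def errSSMech (d s n : ℕ) (ε : ℝ) (xs : Fin n → Fin d) : ℝ :=
  ∑ zt ∈ Fintype.piFinset (fun _ : Fin n => zset d s),
    (∏ i : Fin n, qss d s ε (xs i) (zt i)) *
      ∑ j : Fin d,
        ((1 / (n : ℝ)) * (∑ i : Fin n, xhatSS d s ε (zt i) j) -
            (1 / (n : ℝ)) * (∑ i : Fin n, if j = xs i then (1 : ℝ) else 0)) ^ 2

/-- `n`-user frequency-estimation squared error of MMRC simulating Subset Selection. -/
def errMmrcMech (d s N n : ℕ) (ε : ℝ) (xs : Fin n → Fin d) : ℝ :=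
  ∑ zt ∈ Fintype.piFinset (fun _ : Fin n => zset d s),
    (∏ i : Fin n, qMmrcOut d s N ε (xs i) (zt i)) *
      ∑ j : Fin d,
        ((1 / (n : ℝ)) * (∑ i : Fin n, xhatMmrc d s N ε (zt i) j) -
            (1 / (n : ℝ)) * (∑ i : Fin n, if j = xs i then (1 : ℝ) else 0)) ^ 2

/-- The probability that coordinate `i` of the selected candidate is `1` on input `e_j`. -/
def mmrcMarginal (d s N : ℕ) (ε : ℝ) (j i : Fin d) : ℝ :=
  ∑ zs ∈ Fintype.piFinset (fun _ : Fin N => zset d s),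
    (1 / ((zset d s).card : ℝ)) ^ N *
      ∑ k : Fin N, if i ∈ zs k then piMmrcSS d s N ε j zs k else 0

theorem sum_zset_qMmrcOut (d s N : ℕ) (ε : ℝ) (j i : Fin d) :
    ∑ A ∈ zset d s, (if i ∈ A then qMmrcOut d s N ε j A else 0) =
      mmrcMarginal d s N ε j i := by
  unfold qMmrcOut mmrcMarginal
  rw [← Finset.sum_filter, Finset.sum_comm]
  refine Finset.sum_congr rfl fun zs hzs => ?_
  rw [← Finset.mul_sum, Finset.sum_comm]
  congr 1
  refine Finset.sum_congr rfl fun k _ => ?_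
  have hk := Fintype.mem_piFinset.mp hzs k
  rw [Finset.sum_ite_eq]
  simp [hk]

/-- The law of the number of successes among `N` independent uniform draws from `Z` is binomial. -/
theorem sum_piFinset_eq_binomExp {α : Type*} (Z : Finset α) (hZ : Z.Nonempty) (P : α → Prop)
    (N : ℕ) (f : ℝ → ℝ) :
    ∑ zs ∈ Fintype.piFinset (fun _ : Fin N => Z),
      (1 / (Z.card : ℝ)) ^ N *
        f (((Finset.univ.filter fun k : Fin N => P (zs k)).card : ℝ) / (N : ℝ)) =
      binomExp N (((Z.filter P).card : ℝ) / (Z.card : ℝ)) f := by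
  have hZ0 : (Z.card : ℝ) ≠ 0 := by exact_mod_cast hZ.card_ne_zero
  have hcompl : 1 - ((Z.filter P).card : ℝ) / (Z.card : ℝ) =
      ((Z.filter fun x => ¬ P x).card : ℝ) / (Z.card : ℝ) := by
    have h : ((Z.filter P).card : ℝ) + ((Z.filter fun x => ¬ P x).card : ℝ) = Z.card := by
      exact_mod_cast Finset.card_filter_add_card_filter_not (s := Z) P
    field_simp
    linarith
  have hfiber : ∀ S : Finset (Fin N),
      ((Fintype.piFinset (fun _ : Fin N => Z)).filter
        fun zs => (Finset.univ.filter fun k : Fin N => P (zs k)) = S).card =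
      (Z.filter P).card ^ S.card * (Z.filter fun x => ¬ P x).card ^ (N - S.card) := by
    intro S
    have hset : ((Fintype.piFinset (fun _ : Fin N => Z)).filter
        fun zs => (Finset.univ.filter fun k : Fin N => P (zs k)) = S) =
        Fintype.piFinset (fun k : Fin N =>
          if k ∈ S then Z.filter P else Z.filter fun x => ¬ P x) := by
      ext zs
      simp only [Finset.mem_filter, Fintype.mem_piFinset, Finset.ext_iff, Finset.mem_univ,
        true_and]
      constructor
      · rintro ⟨h1, h2⟩ k
        by_cases hk : k ∈ S
        · simp [hk, h1 k, (h2 k).2 hk]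
        · simp [hk, h1 k, mt (h2 k).1 hk]
      · intro h
        refine ⟨fun k => ?_, fun k => ?_⟩
        · have := h k
          split_ifs at this <;> exact (Finset.mem_filter.mp this).1
        · have := h k
          by_cases hk : k ∈ S
          · simp only [hk, if_true, Finset.mem_filter] at this
            simp [hk, this.2]
          · simp only [hk, if_false, Finset.mem_filter] at this
            simp [hk, this.2]
    rw [hset, Fintype.card_piFinset]
    simp only [apply_ite Finset.card]
    rw [Finset.prod_ite]
    simp only [Finset.prod_const]
    have h1 : (Finset.univ.filter fun k : Fin N => k ∈ S) = S := by ext; simp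
    have h2 : (Finset.univ.filter fun k : Fin N => k ∉ S) = Sᶜ := by ext; simp
    rw [h1, h2, Finset.card_compl, Fintype.card_fin]
  rw [← Finset.sum_fiberwise (Fintype.piFinset (fun _ : Fin N => Z))
    (fun zs => Finset.univ.filter fun k : Fin N => P (zs k))]
  have hstep : ∀ S : Finset (Fin N),
      ∑ zs ∈ (Fintype.piFinset (fun _ : Fin N => Z)).filter
          (fun zs => (Finset.univ.filter fun k : Fin N => P (zs k)) = S),
        (1 / (Z.card : ℝ)) ^ N *
          f (((Finset.univ.filter fun k : Fin N => P (zs k)).card : ℝ) / (N : ℝ)) =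
      (((Z.filter P).card : ℝ) / (Z.card : ℝ)) ^ S.card *
        (1 - ((Z.filter P).card : ℝ) / (Z.card : ℝ)) ^ (N - S.card) *
          f ((S.card : ℝ) / (N : ℝ)) := by
    intro S
    have hS : S.card ≤ N := by simpa using S.card_le_univ
    have hconst : ∀ zs ∈ (Fintype.piFinset (fun _ : Fin N => Z)).filter
          (fun zs => (Finset.univ.filter fun k : Fin N => P (zs k)) = S),
        (1 / (Z.card : ℝ)) ^ N *
          f (((Finset.univ.filter fun k : Fin N => P (zs k)).card : ℝ) / (N : ℝ)) =
        (1 / (Z.card : ℝ)) ^ N * f ((S.card : ℝ) / (N : ℝ)) := by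
      intro zs hzs
      rw [(Finset.mem_filter.mp hzs).2]
    rw [Finset.sum_congr rfl hconst, Finset.sum_const, hfiber S, hcompl, nsmul_eq_mul]
    have hpow : (Z.card : ℝ) ^ N = (Z.card : ℝ) ^ S.card * (Z.card : ℝ) ^ (N - S.card) := by
      rw [← pow_add, Nat.add_sub_cancel' hS]
    rw [div_pow, div_pow, div_pow, hpow]
    push_cast
    field_simp
    simp
  rw [Finset.sum_congr rfl fun S _ => hstep S, ← Finset.powerset_univ,
    Finset.sum_powerset_apply_card (fun m =>
      (((Z.filter P).card : ℝ) / (Z.card : ℝ)) ^ m *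
        (1 - ((Z.filter P).card : ℝ) / (Z.card : ℝ)) ^ (N - m) * f ((m : ℝ) / (N : ℝ)))]
  simp only [Finset.card_univ, Fintype.card_fin, nsmul_eq_mul, binomExp]
  refine Finset.sum_congr rfl fun m _ => ?_
  ring

theorem zset_nonempty {d s : ℕ} (h : s ≤ d) : (zset d s).Nonempty := by
  apply Finset.powersetCard_nonempty.mpr
  simpa using h

theorem card_filter_mem_zset_div {d s : ℕ} (h : s ≤ d) (j : Fin d) :
    (((zset d s).filter fun A => j ∈ A).card : ℝ) / ((zset d s).card : ℝ) =
      (s : ℝ) / (d : ℝ) := by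
  obtain ⟨n, rfl⟩ : ∃ n, d = n + 1 := ⟨d - 1, by have := j.pos; omega⟩
  have hZ : ((zset (n + 1) s).card : ℝ) ≠ 0 := by
    exact_mod_cast (zset_nonempty h).card_ne_zero
  have hout : ((zset (n + 1) s).filter fun A => ¬ j ∈ A) =
      Finset.powersetCard s (Finset.univ.erase j) := by
    ext A
    simp only [zset, Finset.mem_filter, Finset.mem_powersetCard, Finset.subset_univ, true_and,
      Finset.subset_erase]
    tauto
  have hcard : ((zset (n + 1) s).filter fun A => ¬ j ∈ A).card = n.choose s := by
    rw [hout, Finset.card_powersetCard, Finset.card_erase_of_mem (Finset.mem_univ j)]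
    simp
  have hall : (zset (n + 1) s).card = (n + 1).choose s := by simp [zset]
  have hadd := Finset.card_filter_add_card_filter_not (s := zset (n + 1) s) fun A => j ∈ A
  have hmul := Nat.choose_mul_succ_eq n s
  rw [← hcard, ← hall] at hmul
  rw [div_eq_div_iff hZ (by positivity)]
  have hadd' : (((zset (n + 1) s).filter fun A => j ∈ A).card : ℝ) +
      (((zset (n + 1) s).filter fun A => ¬ j ∈ A).card : ℝ) = ((zset (n + 1) s).card : ℝ) := by
    exact_mod_cast hadd
  have hmul' : (((zset (n + 1) s).filter fun A => ¬ j ∈ A).card : ℝ) * ((n : ℝ) + 1) =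
      ((zset (n + 1) s).card : ℝ) * ((n : ℝ) + 1 - s) := by
    have := congrArg (Nat.cast : ℕ → ℝ) hmul
    push_cast [Nat.cast_sub h] at this
    exact this
  push_cast
  linear_combination ((n : ℝ) + 1) * hadd' - hmul'

/-- The in-cap indices carry total mass `g(θ)`, the out-cap ones the rest. -/
theorem sum_piMmrcSS {d s N : ℕ} {ε : ℝ} (hs0 : 0 < s) (hsd : s < d) (hN : 0 < N) (j : Fin d)
    (zs : Fin N → Finset (Fin d)) :
    (∑ k : Fin N, if j ∈ zs k then piMmrcSS d s N ε j zs k else 0) =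
        gMmrc ε ((s : ℝ) / (d : ℝ))
          (((Finset.univ.filter fun k : Fin N => j ∈ zs k).card : ℝ) / (N : ℝ)) ∧
      ∑ k : Fin N, piMmrcSS d s N ε j zs k = 1 := by
  have hdR : (0 : ℝ) < d := by exact_mod_cast hs0.trans hsd
  have hμ0 : (0 : ℝ) < (s : ℝ) / (d : ℝ) := div_pos (by exact_mod_cast hs0) hdR
  have hμ1 : (s : ℝ) / (d : ℝ) < 1 := (div_lt_one hdR).mpr (by exact_mod_cast hsd)
  have hNR : (N : ℝ) ≠ 0 := by exact_mod_cast hN.ne'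
  have hin : ∀ x y : ℝ, (∑ k : Fin N, if j ∈ zs k then (if j ∈ zs k then x else y) else 0) =
      (N : ℝ) *
        (((Finset.univ.filter fun k : Fin N => j ∈ zs k).card : ℝ) / (N : ℝ)) * x := by
    intro x y
    rw [← Finset.sum_filter, Finset.sum_congr rfl
      (g := fun _ => x) (fun k hk => if_pos (Finset.mem_filter.mp hk).2)]
    rw [Finset.sum_const, nsmul_eq_mul, mul_div_cancel₀ _ hNR]
  have hall : ∀ x y : ℝ, (∑ k : Fin N, if j ∈ zs k then x else y) =
      (N : ℝ) *
        (((Finset.univ.filter fun k : Fin N => j ∈ zs k).card : ℝ) / (N : ℝ)) * x +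
      (N : ℝ) *
        (1 - ((Finset.univ.filter fun k : Fin N => j ∈ zs k).card : ℝ) / (N : ℝ)) * y := by
    intro x y
    have hcard : ((Finset.univ.filter fun k : Fin N => j ∈ zs k).card : ℝ) +
        ((Finset.univ.filter fun k : Fin N => ¬ j ∈ zs k).card : ℝ) = N := by
      have := Finset.card_filter_add_card_filter_not (s := (Finset.univ : Finset (Fin N)))
        fun k => j ∈ zs k
      rw [Finset.card_univ, Fintype.card_fin] at this
      exact_mod_cast this
    rw [Finset.sum_ite, Finset.sum_const, Finset.sum_const, nsmul_eq_mul, nsmul_eq_mul,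
      mul_sub, mul_div_cancel₀ _ hNR, mul_one]
    linear_combination y * hcard
  unfold piMmrcSS gMmrc
  dsimp only
  generalize ((Finset.univ.filter fun k : Fin N => j ∈ zs k).card : ℝ) / (N : ℝ) = θ at *
  generalize (s : ℝ) / (d : ℝ) = μ at *
  have ha : 0 < Real.exp ε * μ + (1 - μ) := by
    have := mul_pos (Real.exp_pos ε) hμ0
    linarith
  rcases lt_trichotomy θ μ with h | h | h
  · have h1 : (1 - θ) ≠ 0 := by linarith
    simp only [h, h.le, if_true, hin, hall]
    constructor <;> field_simp <;> ring
  · subst h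
    simp only [lt_irrefl, le_refl, if_true, if_false, hin, hall]
    have ha' : θ * Real.exp ε + (1 - θ) ≠ 0 := by linarith
    constructor <;> field_simp
  · have h1 : θ ≠ 0 := by linarith
    simp only [h, h.not_gt, h.not_ge, if_true, if_false, hin, hall]
    constructor <;> field_simp <;> ring

theorem mmrcMarginal_self {d s N : ℕ} {ε : ℝ} (hs0 : 0 < s) (hsd : s < d) (hN : 0 < N)
    (j : Fin d) : mmrcMarginal d s N ε j j = egMmrc d s N ε := by
  have hratio : (((zset d s).filter fun A => j ∈ A).card : ℝ) / ((zset d s).card : ℝ) =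
      (s : ℝ) / (d : ℝ) := card_filter_mem_zset_div hsd.le j
  have h := sum_piFinset_eq_binomExp (zset d s) (zset_nonempty hsd.le) (fun A => j ∈ A) N
    (gMmrc ε ((s : ℝ) / (d : ℝ)))
  unfold mmrcMarginal egMmrc
  rw [← hratio]
  convert h using 2 with zs
  · rw [(sum_piMmrcSS hs0 hsd hN j zs).1]
    congr!
  · congr!
  · rw [hratio]

theorem sum_mmrcMarginal {d s N : ℕ} {ε : ℝ} (hs0 : 0 < s) (hsd : s < d) (hN : 0 < N)
    (j : Fin d) : ∑ i, mmrcMarginal d s N ε j i = s := by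
  have hZ : ((zset d s).card : ℝ) ≠ 0 := by
    exact_mod_cast (zset_nonempty hsd.le).card_ne_zero
  unfold mmrcMarginal
  rw [Finset.sum_comm]
  have hterm : ∀ zs ∈ Fintype.piFinset (fun _ : Fin N => zset d s),
      ∑ i : Fin d, (1 / ((zset d s).card : ℝ)) ^ N *
        ∑ k : Fin N, (if i ∈ zs k then piMmrcSS d s N ε j zs k else 0) =
      (1 / ((zset d s).card : ℝ)) ^ N * s := by
    intro zs hzs
    rw [← Finset.mul_sum, Finset.sum_comm]
    congr 1
    have hk : ∀ k : Fin N, (∑ i : Fin d, if i ∈ zs k then piMmrcSS d s N ε j zs k else 0) =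
        s * piMmrcSS d s N ε j zs k := by
      intro k
      have hcard : (zs k).card = s :=
        (Finset.mem_powersetCard.mp (Fintype.mem_piFinset.mp hzs k)).2
      rw [← Finset.sum_filter, Finset.sum_const, nsmul_eq_mul, Finset.filter_univ_mem, hcard]
    rw [Finset.sum_congr rfl fun k _ => hk k, ← Finset.mul_sum,
      (sum_piMmrcSS hs0 hsd hN j zs).2, mul_one]
  rw [Finset.sum_congr rfl hterm, Finset.sum_const, Fintype.card_piFinset, nsmul_eq_mul]
  simp only [Finset.prod_const, Finset.card_univ, Fintype.card_fin, div_pow, one_pow]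
  push_cast
  field_simp

theorem mmrcMarginal_perm {d s N : ℕ} {ε : ℝ} {j : Fin d} (σ : Equiv.Perm (Fin d))
    (hσ : σ j = j) (i : Fin d) :
    mmrcMarginal d s N ε j (σ i) = mmrcMarginal d s N ε j i := by
  have hmem : ∀ (l : Fin d) (A : Finset (Fin d)), σ l ∈ A.map σ.toEmbedding ↔ l ∈ A := by
    intro l A
    exact Finset.mem_map' σ.toEmbedding
  have hj : ∀ A : Finset (Fin d), j ∈ A.map σ.toEmbedding ↔ j ∈ A := by
    intro A
    simpa only [hσ] using hmem j A
  unfold mmrcMarginal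
  symm
  refine Finset.sum_equiv (Equiv.piCongrRight fun _ : Fin N => σ.finsetCongr) ?_ ?_
  · intro zs
    simp [Fintype.mem_piFinset, zset, Finset.mem_powersetCard]
  · intro zs _
    simp only [Equiv.piCongrRight_apply, Pi.map_apply, Equiv.finsetCongr_apply, hmem, piMmrcSS,
      hj]

theorem mmrcMarginal_of_ne {d s N : ℕ} {ε : ℝ} (hd : 2 ≤ d) (hs0 : 0 < s) (hsd : s < d)
    (hN : 0 < N) {i j : Fin d} (hij : i ≠ j) :
    mmrcMarginal d s N ε j i = bMmrcSS d s N ε := by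
  have hsum := sum_mmrcMarginal (ε := ε) hs0 hsd hN j
  have hconst : ∀ l ∈ Finset.univ.erase j,
      mmrcMarginal d s N ε j l = mmrcMarginal d s N ε j i := by
    intro l hl
    have h := mmrcMarginal_perm (s := s) (N := N) (ε := ε) (Equiv.swap i l)
      (Equiv.swap_apply_of_ne_of_ne hij.symm (Finset.ne_of_mem_erase hl).symm) i
    rwa [Equiv.swap_apply_left] at h
  rw [← Finset.add_sum_erase _ _ (Finset.mem_univ j), mmrcMarginal_self hs0 hsd hN,
    Finset.sum_congr rfl hconst, Finset.sum_const,
    Finset.card_erase_of_mem (Finset.mem_univ j), Finset.card_univ, Fintype.card_fin,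
    nsmul_eq_mul, Nat.cast_sub (by omega), Nat.cast_one] at hsum
  have hd1 : (d : ℝ) - 1 ≠ 0 := by
    have : (2 : ℝ) ≤ d := by exact_mod_cast hd
    linarith
  unfold bMmrcSS
  field_simp
  linarith

/-- The Subset Selection cap size is a proper positive number of coordinates. -/
theorem ceil_div_one_add_exp_mem {d : ℕ} (hd : 2 ≤ d) {ε : ℝ} (hε : 0 ≤ ε) :
    0 < ⌈(d : ℝ) / (1 + Real.exp ε)⌉₊ ∧ ⌈(d : ℝ) / (1 + Real.exp ε)⌉₊ < d := by
  have hdR : (2 : ℝ) ≤ d := by exact_mod_cast hd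
  have hexp : 1 ≤ Real.exp ε := Real.one_le_exp hε
  refine ⟨Nat.ceil_pos.mpr (by positivity), ?_⟩
  have hle : ⌈(d : ℝ) / (1 + Real.exp ε)⌉₊ ≤ d - 1 := by
    rw [Nat.ceil_le, Nat.cast_sub (by omega), Nat.cast_one, div_le_iff₀ (by positivity)]
    nlinarith
  omega

/-- **Lemma I.1.**  The coordinate marginals of MMRC simulating Subset Selection are
linear in the prior: `P((Z_K)_i = 1) = p_i·m_mmrc + b_mmrc`. -/
theorem mmrc_ss_marginal_linear
    (d : ℕ) (hd : 2 ≤ d) (ε : ℝ) (hε1 : 1 ≤ ε)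
    (s : ℕ) (hs : s = ⌈(d : ℝ) / (1 + Real.exp ε)⌉₊)
    (N : ℕ) (hN0 : 0 < N)
    (p : Fin d → ℝ) (hp0 : ∀ i, 0 ≤ p i) (hp1 : ∑ i : Fin d, p i = 1) :
    ∀ i : Fin d,
      (∑ j : Fin d, p j * ∑ A ∈ zset d s, (if i ∈ A then qMmrcOut d s N ε j A else 0))
        = p i * mMmrcSS d s N ε + bMmrcSS d s N ε := by
  intro i
  obtain ⟨hs0, hsd⟩ : 0 < s ∧ s < d := by
    rw [hs]
    exact ceil_div_one_add_exp_mem hd (zero_le_one.trans hε1)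
  have hd1 : (d : ℝ) - 1 ≠ 0 := by
    have : (2 : ℝ) ≤ d := by exact_mod_cast hd
    linarith
  have hrest : ∑ j ∈ Finset.univ.erase i, p j = 1 - p i := by
    rw [← hp1, ← Finset.add_sum_erase _ _ (Finset.mem_univ i), add_sub_cancel_left]
  have hoff : ∀ j ∈ Finset.univ.erase i,
      p j * mmrcMarginal d s N ε j i = p j * bMmrcSS d s N ε := fun j hj => by
    rw [mmrcMarginal_of_ne hd hs0 hsd hN0 (Finset.ne_of_mem_erase hj).symm]
  simp only [sum_zset_qMmrcOut]
  rw [← Finset.add_sum_erase _ _ (Finset.mem_univ i), Finset.sum_congr rfl hoff,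
    ← Finset.sum_mul, hrest, mmrcMarginal_self hs0 hsd hN0]
  unfold mMmrcSS bMmrcSS
  field_simp
  ring
end
end

section
/- Run MMRC simulating Subset Selection on a deterministic one-hot input x ∈ {0,1}^d with N candidates, and assume m_mmrc ≠ 0. Then the estimator x̂^mmrc := (Z_K − b_mmrc·𝟙)/m_mmrc is unbiased: E[x̂^mmrc] = x, where the expectation is over the i.i.d. uniform candidates and the selected index K. -/
open scoped Classical
open Real Finset

noncomputable section

/-- Grouping functions by the set of coordinates at which `p` holds. -/
theorem sum_piFinset_card_filter {α : Type*} (S : Finset α) (p : α → Prop) [DecidablePred p]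
    (N : ℕ) (φ : ℕ → ℝ) :
    ∑ zs ∈ Fintype.piFinset (fun _ : Fin N => S), φ #{k | p (zs k)} =
      ∑ M ∈ range (N + 1),
        (N.choose M : ℝ) * (#{a ∈ S | p a} : ℝ) ^ M * (#{a ∈ S | ¬ p a} : ℝ) ^ (N - M) * φ M := by
  have hfiber (B : Finset (Fin N)) :
      #{zs ∈ Fintype.piFinset (fun _ : Fin N => S) | ({k | p (zs k)} : Finset (Fin N)) = B} =
        #{a ∈ S | p a} ^ #B * #{a ∈ S | ¬ p a} ^ (N - #B) := by
    have hset : {zs ∈ Fintype.piFinset (fun _ : Fin N => S) |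
        ({k | p (zs k)} : Finset (Fin N)) = B} =
        Fintype.piFinset fun k => if k ∈ B then {a ∈ S | p a} else {a ∈ S | ¬ p a} := by
      ext zs
      simp only [mem_filter, Fintype.mem_piFinset, Finset.ext_iff, mem_univ, true_and,
        ← forall_and]
      refine forall_congr' fun k => ?_
      split_ifs with hk <;> simp [hk]
    rw [hset, Fintype.card_piFinset]
    simp only [apply_ite Finset.card]
    rw [prod_ite]
    simp [filter_not, card_sdiff]
  rw [← sum_fiberwise_of_maps_to (t := (univ : Finset (Fin N)).powerset)
    (g := fun zs => ({k | p (zs k)} : Finset (Fin N))) (fun _ _ => by simp)]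
  have hinner (B : Finset (Fin N)) :
      ∑ zs ∈ Fintype.piFinset (fun _ : Fin N => S) with
        ({k | p (zs k)} : Finset (Fin N)) = B, φ #{k | p (zs k)} =
      (#{a ∈ S | p a} : ℝ) ^ #B * (#{a ∈ S | ¬ p a} : ℝ) ^ (N - #B) * φ #B := by
    rw [sum_congr rfl (g := fun _ => φ #B) fun zs hzs => by rw [(mem_filter.1 hzs).2],
      sum_const, hfiber, nsmul_eq_mul]
    push_cast
    ring
  simp only [hinner]
  rw [sum_powerset_apply_card (fun m => (#{a ∈ S | p a} : ℝ) ^ m *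
    (#{a ∈ S | ¬ p a} : ℝ) ^ (N - m) * φ m)]
  simp [mul_assoc]

theorem card_zset (d s : ℕ) : #(zset d s) = d.choose s := by
  simp [zset]

theorem card_zset_pos {d s : ℕ} (hsd : s ≤ d) : (0 : ℝ) < #(zset d s) := by
  rw [card_zset]
  exact_mod_cast Nat.choose_pos hsd

theorem card_zset_notMem {d s : ℕ} (hd : 0 < d) (hsd : s ≤ d) (j : Fin d) :
    (#{A ∈ zset d s | j ∉ A} : ℝ) = (1 - (s : ℝ) / d) * #(zset d s) := by
  have hset : {A ∈ zset d s | j ∉ A} = powersetCard s (univ.erase j) := by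
    ext A
    simp [zset, mem_powersetCard, subset_erase, and_comm]
  rw [hset, card_powersetCard, card_erase_of_mem (mem_univ j), card_zset, card_univ,
    Fintype.card_fin]
  obtain ⟨n, rfl⟩ := Nat.exists_eq_succ_of_ne_zero hd.ne'
  have h := congrArg (Nat.cast (R := ℝ)) (Nat.choose_mul_succ_eq n s)
  rw [Nat.cast_mul, Nat.cast_mul, Nat.cast_sub hsd] at h
  have hn : ((n.succ : ℕ) : ℝ) ≠ 0 := by positivity
  field_simp
  simpa [mul_comm] using h

theorem card_zset_mem {d s : ℕ} (hd : 0 < d) (hsd : s ≤ d) (j : Fin d) :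
    (#{A ∈ zset d s | j ∈ A} : ℝ) = (s : ℝ) / d * #(zset d s) := by
  have h := congrArg (Nat.cast (R := ℝ))
    (card_filter_add_card_filter_not (s := zset d s) fun A => j ∈ A)
  rw [Nat.cast_add, card_zset_notMem hd hsd] at h
  linarith

/-- The number of in-cap candidates is binomial. -/
theorem sum_candidates_eq_binomExp {d s : ℕ} (hd : 0 < d) (hsd : s ≤ d) (N : ℕ) (j : Fin d)
    (f : ℝ → ℝ) :
    ∑ zs ∈ Fintype.piFinset (fun _ : Fin N => zset d s),
      (1 / (#(zset d s) : ℝ)) ^ N * f ((#{k | j ∈ zs k} : ℝ) / N) =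
      binomExp N ((s : ℝ) / d) f := by
  rw [← mul_sum, sum_piFinset_card_filter (zset d s) (fun A => j ∈ A) N
    (fun M => f ((M : ℝ) / N)), mul_sum, binomExp]
  refine sum_congr rfl fun M hM => ?_
  have hc := (card_zset_pos hsd).ne'
  have hMN : M + (N - M) = N := by have := mem_range.1 hM; omega
  have hpow : (1 / (#(zset d s) : ℝ)) ^ N *
      ((#(zset d s) : ℝ) ^ M * (#(zset d s) : ℝ) ^ (N - M)) = 1 := by
    rw [← pow_add, hMN, ← mul_pow, one_div_mul_cancel hc, one_pow]
  rw [card_zset_mem hd hsd, card_zset_notMem hd hsd, mul_pow, mul_pow]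
  linear_combination ((N.choose M : ℝ) * ((s : ℝ) / d) ^ M * (1 - (s : ℝ) / d) ^ (N - M) *
    f ((M : ℝ) / N)) * hpow

/-- Summing over the indices a function that only depends on being in-cap. -/
theorem sum_ite_mem_eq {d N : ℕ} (hN : 0 < N) (j : Fin d) (zs : Fin N → Finset (Fin d))
    (u v : ℝ) :
    ∑ k, (if j ∈ zs k then u else v) =
      N * ((#{k | j ∈ zs k} : ℝ) / N * u + (1 - (#{k | j ∈ zs k} : ℝ) / N) * v) := by
  have h := congrArg (Nat.cast (R := ℝ))
    (card_filter_add_card_filter_not (s := (univ : Finset (Fin N))) fun k => j ∈ zs k)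
  have hN' : (N : ℝ) ≠ 0 := by positivity
  rw [sum_ite, sum_const, sum_const, nsmul_eq_mul, nsmul_eq_mul]
  rw [Nat.cast_add, card_univ, Fintype.card_fin] at h
  field_simp
  linear_combination v * h

theorem mmrc_normalizer_pos {ε μ : ℝ} (h0 : 0 < μ) (h1 : μ < 1) :
    0 < exp ε * μ + (1 - μ) := by
  have := mul_pos (exp_pos ε) h0
  linarith

theorem sum_piMmrcSS_s10 {d s N : ℕ} (hN : 0 < N) (ε : ℝ) (h0 : 0 < (s : ℝ) / d)
    (h1 : (s : ℝ) / d < 1) (j : Fin d) (zs : Fin N → Finset (Fin d)) :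
    ∑ k, piMmrcSS d s N ε j zs k = 1 := by
  have ha := (mmrc_normalizer_pos (ε := ε) h0 h1).ne'
  have hN' : (N : ℝ) ≠ 0 := by positivity
  simp only [piMmrcSS]
  split_ifs with hlt hgt
  · rw [sum_ite_mem_eq hN]
    have : 1 - (#{k | j ∈ zs k} : ℝ) / N ≠ 0 := by linarith
    generalize (#{k | j ∈ zs k} : ℝ) / N = θ at *
    generalize (s : ℝ) / d = μ at *
    field_simp
    ring
  · rw [sum_ite_mem_eq hN]
    have : (#{k | j ∈ zs k} : ℝ) / N ≠ 0 := by linarith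
    generalize (#{k | j ∈ zs k} : ℝ) / N = θ at *
    generalize (s : ℝ) / d = μ at *
    field_simp
    ring
  · rw [sum_ite_mem_eq hN]
    have : (#{k | j ∈ zs k} : ℝ) / N = (s : ℝ) / d := by linarith
    rw [this]
    generalize (s : ℝ) / d = μ at *
    field_simp
    exact div_self (by rwa [mul_comm μ])

theorem sum_piMmrcSS_mem {d s N : ℕ} (hN : 0 < N) (ε : ℝ) (h0 : 0 < (s : ℝ) / d)
    (h1 : (s : ℝ) / d < 1) (j : Fin d) (zs : Fin N → Finset (Fin d)) :
    ∑ k, piMmrcSS d s N ε j zs k * (if j ∈ zs k then 1 else 0) =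
      gMmrc ε ((s : ℝ) / d) ((#{k | j ∈ zs k} : ℝ) / N) := by
  have ha := (mmrc_normalizer_pos (ε := ε) h0 h1).ne'
  have hN' : (N : ℝ) ≠ 0 := by positivity
  have hite (k : Fin N) (u v : ℝ) : (if j ∈ zs k then u else v) * (if j ∈ zs k then 1 else 0) =
      if j ∈ zs k then u else 0 := by split_ifs <;> simp
  simp only [piMmrcSS, gMmrc]
  split_ifs with hlt hle hgt hle hle
  all_goals simp only [hite]; rw [sum_ite_mem_eq hN]
  · generalize (#{k | j ∈ zs k} : ℝ) / N = θ at *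
    generalize (s : ℝ) / d = μ at *
    field_simp
    ring
  · exact absurd hlt.le hle
  · exact absurd hgt hle.not_gt
  · have : (#{k | j ∈ zs k} : ℝ) / N ≠ 0 := by linarith
    generalize (#{k | j ∈ zs k} : ℝ) / N = θ at *
    generalize (s : ℝ) / d = μ at *
    field_simp
    ring
  · have : (#{k | j ∈ zs k} : ℝ) / N = (s : ℝ) / d := by linarith
    rw [this]
    generalize (s : ℝ) / d = μ at *
    field_simp
    ring
  · exact absurd (not_lt.1 hgt) hle

/-- The law of the output as an average over candidates and selected index. -/
theorem sum_qMmrcOut_mul (d s N : ℕ) (ε : ℝ) (j : Fin d) (f : Finset (Fin d) → ℝ) :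
    ∑ A ∈ zset d s, qMmrcOut d s N ε j A * f A =
      ∑ zs ∈ Fintype.piFinset (fun _ : Fin N => zset d s),
        (1 / (#(zset d s) : ℝ)) ^ N * ∑ k, piMmrcSS d s N ε j zs k * f (zs k) := by
  simp only [qMmrcOut, sum_mul]
  rw [sum_comm]
  refine sum_congr rfl fun zs hzs => ?_
  simp only [mul_assoc, ← mul_sum, sum_mul]
  rw [sum_comm]
  congr 1
  refine sum_congr rfl fun k _ => ?_
  simp [ite_mul, Fintype.mem_piFinset.1 hzs k]

theorem sum_qMmrcOut {d s N : ℕ} (hN : 0 < N) (ε : ℝ) (hs : 0 < s) (hsd : s < d) (j : Fin d) :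
    ∑ A ∈ zset d s, qMmrcOut d s N ε j A = 1 := by
  have hd : (0 : ℝ) < d := by exact_mod_cast hs.trans hsd
  have h0 : 0 < (s : ℝ) / d := by positivity
  have h1 : (s : ℝ) / d < 1 := (div_lt_one hd).2 (by exact_mod_cast hsd)
  have h := sum_qMmrcOut_mul d s N ε j fun _ => 1
  simp only [mul_one, sum_piMmrcSS_s10 hN ε h0 h1] at h
  rw [h, sum_const, Fintype.card_piFinset, prod_const, card_univ, Fintype.card_fin,
    nsmul_eq_mul, Nat.cast_pow, ← mul_pow, mul_one_div_cancel (card_zset_pos hsd.le).ne', one_pow]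

theorem sum_qMmrcOut_mem_self {d s N : ℕ} (hN : 0 < N) (ε : ℝ) (hs : 0 < s) (hsd : s < d)
    (j : Fin d) :
    ∑ A ∈ zset d s, qMmrcOut d s N ε j A * (if j ∈ A then 1 else 0) = egMmrc d s N ε := by
  have hd : (0 : ℝ) < d := by exact_mod_cast hs.trans hsd
  have h0 : 0 < (s : ℝ) / d := by positivity
  have h1 : (s : ℝ) / d < 1 := (div_lt_one hd).2 (by exact_mod_cast hsd)
  rw [sum_qMmrcOut_mul]
  simp only [sum_piMmrcSS_mem hN ε h0 h1]
  exact sum_candidates_eq_binomExp (hs.trans hsd) hsd.le N j _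

theorem map_mem_zset_iff {d s : ℕ} (σ : Equiv.Perm (Fin d)) (A : Finset (Fin d)) :
    A.map σ.toEmbedding ∈ zset d s ↔ A ∈ zset d s := by
  simp [zset, mem_powersetCard]

/-- The output law is invariant under relabelings fixing the input coordinate. -/
theorem qMmrcOut_map (d s N : ℕ) (ε : ℝ) {j : Fin d} {σ : Equiv.Perm (Fin d)} (hσ : σ j = j)
    (A : Finset (Fin d)) :
    qMmrcOut d s N ε j (A.map σ.toEmbedding) = qMmrcOut d s N ε j A := by
  have hsymm : σ.symm j = j := σ.symm_apply_eq.2 hσ.symm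
  symm
  unfold qMmrcOut
  refine sum_equiv (Equiv.piCongrRight fun _ => σ.finsetCongr) (fun zs => ?_) fun zs _ => ?_
  · simp [Fintype.mem_piFinset, map_mem_zset_iff]
  · congr 1
    refine sum_congr rfl fun k _ => ?_
    simp [piMmrcSS, hsymm]

theorem sum_qMmrcOut_mem_congr (d s N : ℕ) (ε : ℝ) {j i i' : Fin d} (hi : i ≠ j) (hi' : i' ≠ j) :
    ∑ A ∈ zset d s, qMmrcOut d s N ε j A * (if i ∈ A then 1 else 0) =
      ∑ A ∈ zset d s, qMmrcOut d s N ε j A * (if i' ∈ A then 1 else 0) := by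
  have hσ : Equiv.swap i i' j = j := Equiv.swap_apply_of_ne_of_ne hi.symm hi'.symm
  refine sum_equiv (Equiv.swap i i').finsetCongr (fun A => ?_) fun A _ => ?_
  · simp [map_mem_zset_iff]
  · have hmem : i' ∈ A.map (Equiv.swap i i').toEmbedding ↔ i ∈ A := by simp
    rw [Equiv.finsetCongr_apply, qMmrcOut_map d s N ε hσ]
    simp only [hmem]

theorem sum_qMmrcOut_mem_of_ne {d s N : ℕ} (hN : 0 < N) (ε : ℝ) (hs : 0 < s) (hsd : s < d)
    {j i : Fin d} (hi : i ≠ j) :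
    ∑ A ∈ zset d s, qMmrcOut d s N ε j A * (if i ∈ A then 1 else 0) = bMmrcSS d s N ε := by
  have htotal : ∑ i' : Fin d, ∑ A ∈ zset d s,
      qMmrcOut d s N ε j A * (if i' ∈ A then 1 else 0) = s := by
    rw [sum_comm]
    have hcard : ∀ A ∈ zset d s, ∑ i' : Fin d,
        qMmrcOut d s N ε j A * (if i' ∈ A then 1 else 0) = qMmrcOut d s N ε j A * s := by
      intro A hA
      rw [← mul_sum]
      simp [(mem_powersetCard.1 hA).2]
    rw [sum_congr rfl hcard, ← sum_mul, sum_qMmrcOut hN ε hs hsd, one_mul]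
  rw [← add_sum_erase _ _ (mem_univ j), sum_qMmrcOut_mem_self hN ε hs hsd,
    sum_congr rfl fun i' hi' => sum_qMmrcOut_mem_congr d s N ε (ne_of_mem_erase hi') hi,
    sum_const, card_erase_of_mem (mem_univ j), card_univ, Fintype.card_fin, nsmul_eq_mul,
    Nat.cast_sub (by omega), Nat.cast_one] at htotal
  have hd : (d : ℝ) - 1 ≠ 0 := by
    have : (1 : ℝ) < d := by exact_mod_cast (by omega : 1 < d)
    linarith
  rw [bMmrcSS]
  field_simp
  linarith

theorem subsetSize_pos_and_lt {d : ℕ} (hd : 2 ≤ d) {ε : ℝ} (hε : 0 ≤ ε) :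
    0 < ⌈(d : ℝ) / (1 + exp ε)⌉₊ ∧ ⌈(d : ℝ) / (1 + exp ε)⌉₊ < d := by
  have hd' : (2 : ℝ) ≤ d := by exact_mod_cast hd
  have hexp := one_le_exp hε
  refine ⟨Nat.ceil_pos.2 (by positivity), ?_⟩
  have hle : ⌈(d : ℝ) / (1 + exp ε)⌉₊ ≤ d - 1 := by
    rw [Nat.ceil_le, Nat.cast_sub (by omega), Nat.cast_one, div_le_iff₀ (by positivity)]
    nlinarith
  omega

/-- **Lemma 2 (unbiasedness of the MMRC estimator simulating Subset Selection).**
For a deterministic one-hot input `x = e_j`, if `m_mmrc ≠ 0` then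
`E[x̂^mmrc] = x`, where `x̂^mmrc = (Z_K − b_mmrc·𝟙)/m_mmrc` and the expectation is over
the i.i.d. uniform candidates and the selected index. -/
theorem mmrc_ss_unbiased
    (d : ℕ) (hd : 2 ≤ d) (ε : ℝ) (hε1 : 1 ≤ ε)
    (s : ℕ) (hs : s = ⌈(d : ℝ) / (1 + Real.exp ε)⌉₊)
    (N : ℕ) (hN0 : 0 < N)
    (hm : mMmrcSS d s N ε ≠ 0) :
    ∀ j i : Fin d,
      (∑ A ∈ zset d s, qMmrcOut d s N ε j A * xhatMmrc d s N ε A i)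
        = (if i = j then (1 : ℝ) else 0) := by
  obtain ⟨hs0, hsd⟩ : 0 < s ∧ s < d := hs ▸ subsetSize_pos_and_lt hd (zero_le_one.trans hε1)
  intro j i
  have hsplit : ∑ A ∈ zset d s, qMmrcOut d s N ε j A * xhatMmrc d s N ε A i =
      (∑ A ∈ zset d s, qMmrcOut d s N ε j A * (if i ∈ A then 1 else 0) - bMmrcSS d s N ε) /
        mMmrcSS d s N ε := by
    simp only [xhatMmrc, mul_div_assoc', mul_sub, ← sum_div, sum_sub_distrib, ← sum_mul,
      sum_qMmrcOut hN0 ε hs0 hsd, one_mul]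
  rw [hsplit]
  split_ifs with hij
  · subst hij
    rw [sum_qMmrcOut_mem_self hN0 ε hs0 hsd, div_eq_one_iff_eq hm, mMmrcSS, bMmrcSS]
    have : (d : ℝ) - 1 ≠ 0 := by
      have : (2 : ℝ) ≤ d := by exact_mod_cast hd
      linarith
    field_simp
    ring
  · rw [sum_qMmrcOut_mem_of_ne hN0 ε hs0 hsd hij, sub_self, zero_div]
end
end

section
/- Assume additionally ε ≤ d−1. For any λ > 0, if the number of candidates N satisfies N ≥ 2(e^ε+3)²(1+λ)²/(0.24²·λ²)·ln(8(1+λ)/(0.24·λ)), then m_ss − m_mrc ≤ λ·m_mrc and b_ss ≤ b_mrc. -/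
open scoped Classical
open Real Finset

noncomputable section

/-- Expectation of a quadratic polynomial under the rescaled binomial distribution. -/
theorem binomExp_quadratic {N : ℕ} (hN : 0 < N) (μ c₀ c₁ c₂ : ℝ) :
    binomExp N μ (fun θ => c₀ + c₁ * (θ - μ) + c₂ * (θ - μ) ^ 2) =
      c₀ + c₂ * (μ * (1 - μ) / N) := by
  have hN' : (N : ℝ) ≠ 0 := by positivity
  have total := congrArg (Polynomial.eval μ) (bernsteinPolynomial.sum ℝ N)
  have mean := congrArg (Polynomial.eval μ) (bernsteinPolynomial.sum_smul ℝ N)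
  have var := congrArg (Polynomial.eval μ) (bernsteinPolynomial.variance ℝ N)
  simp only [bernsteinPolynomial, Polynomial.eval_finsetSum, nsmul_eq_mul, Polynomial.eval_mul,
    Polynomial.eval_pow, Polynomial.eval_sub, Polynomial.eval_natCast, Polynomial.eval_X,
    Polynomial.eval_one] at total mean var
  have key : binomExp N μ (fun θ => c₀ + c₁ * (θ - μ) + c₂ * (θ - μ) ^ 2) =
      (c₀ - c₁ * μ) * (∑ M ∈ range (N + 1), (N.choose M : ℝ) * μ ^ M * (1 - μ) ^ (N - M)) +
      c₁ / N * (∑ M ∈ range (N + 1),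
        (M : ℝ) * ((N.choose M : ℝ) * μ ^ M * (1 - μ) ^ (N - M))) +
      c₂ / N ^ 2 * (∑ M ∈ range (N + 1),
        ((N : ℝ) * μ - M) ^ 2 * ((N.choose M : ℝ) * μ ^ M * (1 - μ) ^ (N - M))) := by
    simp only [binomExp, mul_sum, ← sum_add_distrib]
    refine sum_congr rfl fun M _ => ?_
    field_simp
    ring
  rw [key, total, mean, var]
  field_simp
  ring

/-- Monotonicity of the rescaled binomial expectation. -/
theorem binomExp_mono {N : ℕ} {μ : ℝ} (h0 : 0 ≤ μ) (h1 : μ ≤ 1) {f g : ℝ → ℝ}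
    (hfg : ∀ θ, 0 ≤ θ → θ ≤ 1 → f θ ≤ g θ) : binomExp N μ f ≤ binomExp N μ g := by
  refine sum_le_sum fun M hM => mul_le_mul_of_nonneg_left (hfg _ (by positivity) ?_) ?_
  · exact div_le_one_of_le₀ (by exact_mod_cast mem_range_succ_iff.mp hM) (by positivity)
  · have : 0 ≤ 1 - μ := sub_nonneg.mpr h1
    positivity

theorem hMrc_denom_one_le {ε θ : ℝ} (hε : 0 ≤ ε) (h0 : 0 ≤ θ) :
    1 ≤ Real.exp ε * θ + (1 - θ) := by
  nlinarith [Real.one_le_exp hε]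

/-- Second-order expansion of `hMrc ε` around `μ`, with exact remainder. -/
theorem hMrc_expansion {ε μ θ : ℝ} (hε : 0 ≤ ε) (hμ : 0 ≤ μ) (hθ : 0 ≤ θ) :
    hMrc ε θ = hMrc ε μ + Real.exp ε / (Real.exp ε * μ + (1 - μ)) ^ 2 * (θ - μ) -
      Real.exp ε * (Real.exp ε - 1) / (Real.exp ε * μ + (1 - μ)) ^ 2 * (θ - μ) ^ 2 /
        (Real.exp ε * θ + (1 - θ)) := by
  have hm : Real.exp ε * μ + (1 - μ) ≠ 0 := by linarith [hMrc_denom_one_le hε hμ]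
  have ht : Real.exp ε * θ + (1 - θ) ≠ 0 := by linarith [hMrc_denom_one_le hε hθ]
  unfold hMrc
  field_simp
  ring

/-- Jensen's inequality for the concave function `hMrc ε`. -/
theorem binomExp_hMrc_le {N : ℕ} (hN : 0 < N) {ε μ : ℝ} (hε : 0 ≤ ε) (h0 : 0 ≤ μ) (h1 : μ ≤ 1) :
    binomExp N μ (hMrc ε) ≤ hMrc ε μ := by
  have hE : 0 ≤ Real.exp ε - 1 := by linarith [Real.one_le_exp hε]
  calc binomExp N μ (hMrc ε)
      ≤ binomExp N μ (fun θ => hMrc ε μ +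
          Real.exp ε / (Real.exp ε * μ + (1 - μ)) ^ 2 * (θ - μ) + 0 * (θ - μ) ^ 2) := by
        refine binomExp_mono h0 h1 fun θ hθ _ => ?_
        have ht : 0 ≤ Real.exp ε * θ + (1 - θ) := by linarith [hMrc_denom_one_le hε hθ]
        rw [hMrc_expansion hε h0 hθ, zero_mul, add_zero]
        exact sub_le_self _ (by positivity)
    _ = hMrc ε μ := by rw [binomExp_quadratic hN]; ring

/-- The Jensen gap of `hMrc ε` is controlled by the variance of the rescaled binomial. -/
theorem hMrc_sub_le_binomExp {N : ℕ} (hN : 0 < N) {ε μ : ℝ} (hε : 0 ≤ ε) (h0 : 0 ≤ μ)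
    (h1 : μ ≤ 1) :
    hMrc ε μ - Real.exp ε * (Real.exp ε - 1) / (Real.exp ε * μ + (1 - μ)) ^ 2 *
      (μ * (1 - μ) / N) ≤ binomExp N μ (hMrc ε) := by
  have hE : 0 ≤ Real.exp ε - 1 := by linarith [Real.one_le_exp hε]
  rw [sub_eq_add_neg, ← neg_mul, ← binomExp_quadratic hN μ (hMrc ε μ)
    (Real.exp ε / (Real.exp ε * μ + (1 - μ)) ^ 2)]
  refine binomExp_mono h0 h1 fun θ hθ _ => ?_
  rw [hMrc_expansion hε h0 hθ, neg_mul, ← sub_eq_add_neg]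
  exact sub_le_sub_left (div_le_self (by positivity) (hMrc_denom_one_le hε hθ)) _

/-- The gap `h(μ) - E[h(θ)]` is at most a fraction `lam / (1 + lam)` of `h(μ) - μ`. -/
theorem hMrc_sub_le_mul_binomExp_sub {N : ℕ} (hN : 0 < N) {ε μ lam : ℝ} (hε : 0 ≤ ε)
    (h0 : 0 ≤ μ) (h1 : μ ≤ 1) (hlam : 0 < lam) (hNl : Real.exp ε * (1 + lam) / lam ≤ N) :
    hMrc ε μ - μ ≤ (1 + lam) * (binomExp N μ (hMrc ε) - μ) := by
  have hE : 0 ≤ Real.exp ε - 1 := by linarith [Real.one_le_exp hε]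
  have ha := hMrc_denom_one_le hε h0
  set a := Real.exp ε * μ + (1 - μ) with ha_def
  have ha0 : 0 < a := by linarith
  have hN' : (0 : ℝ) < N := by exact_mod_cast hN
  have hm : 0 ≤ μ * (1 - μ) := mul_nonneg h0 (sub_nonneg.mpr h1)
  have hgap : hMrc ε μ - μ = (Real.exp ε - 1) * (μ * (1 - μ)) / a := by
    rw [hMrc, ← ha_def]
    field_simp
    rw [ha_def]
    ring
  have hfrac : Real.exp ε * (1 + lam) / (a * N) ≤ lam := by
    rw [div_le_iff₀ (by positivity)]
    rw [div_le_iff₀ hlam] at hNl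
    nlinarith [mul_le_mul_of_nonneg_right ha (mul_pos hlam hN').le]
  have hvar : (1 + lam) * (Real.exp ε * (Real.exp ε - 1) / a ^ 2 * (μ * (1 - μ) / N)) ≤
      lam * (hMrc ε μ - μ) := by
    calc (1 + lam) * (Real.exp ε * (Real.exp ε - 1) / a ^ 2 * (μ * (1 - μ) / N))
        = Real.exp ε * (1 + lam) / (a * N) * ((Real.exp ε - 1) * (μ * (1 - μ)) / a) := by
          field_simp
      _ ≤ lam * ((Real.exp ε - 1) * (μ * (1 - μ)) / a) :=
          mul_le_mul_of_nonneg_right hfrac (by positivity)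
      _ = lam * (hMrc ε μ - μ) := by rw [hgap]
  have := mul_le_mul_of_nonneg_left (hMrc_sub_le_binomExp hN hε h0 h1)
    (by positivity : 0 ≤ 1 + lam)
  rw [← ha_def] at this
  linarith

/-- The required number of candidates exceeds `e^ε (1 + lam) / lam`. -/
theorem exp_mul_div_le_candidates {ε lam : ℝ} (hlam : 0 < lam) :
    Real.exp ε * (1 + lam) / lam ≤
      2 * (Real.exp ε + 3) ^ 2 * (1 + lam) ^ 2 / ((0.24 : ℝ) ^ 2 * lam ^ 2) *
        Real.log (8 * (1 + lam) / ((0.24 : ℝ) * lam)) := by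
  have hE := Real.exp_pos ε
  have hr : 1 ≤ (1 + lam) / lam := by rw [le_div_iff₀ hlam]; linarith
  have hlog : 1 ≤ Real.log (8 * (1 + lam) / ((0.24 : ℝ) * lam)) := by
    rw [Real.le_log_iff_exp_le (by positivity),
      show 8 * (1 + lam) / ((0.24 : ℝ) * lam) = 8 / 0.24 * ((1 + lam) / lam) by field_simp]
    have h3 := Real.exp_one_lt_d9
    norm_num at h3 ⊢
    linarith
  have hfac : Real.exp ε * (1 + lam) / lam ≤
      2 * (Real.exp ε + 3) ^ 2 * (1 + lam) ^ 2 / ((0.24 : ℝ) ^ 2 * lam ^ 2) := by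
    rw [show 2 * (Real.exp ε + 3) ^ 2 * (1 + lam) ^ 2 / ((0.24 : ℝ) ^ 2 * lam ^ 2) =
      2 / 0.24 ^ 2 * (Real.exp ε + 3) ^ 2 * ((1 + lam) / lam) * ((1 + lam) / lam) by field_simp,
      mul_div_assoc]
    have hsq : Real.exp ε ≤ 2 / 0.24 ^ 2 * (Real.exp ε + 3) ^ 2 := by norm_num; nlinarith
    calc Real.exp ε * ((1 + lam) / lam)
        ≤ 2 / 0.24 ^ 2 * (Real.exp ε + 3) ^ 2 * ((1 + lam) / lam) := by gcongr
      _ ≤ _ := le_mul_of_one_le_right (by positivity) hr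
  exact hfac.trans (le_mul_of_one_le_right (by positivity) hlog)

theorem hMrc_natCast_div {d s : ℕ} (hd : d ≠ 0) {ε : ℝ} :
    hMrc ε ((s : ℝ) / d) = Real.exp ε * s / (s * (Real.exp ε - 1) + d) := by
  rw [hMrc, show Real.exp ε * ((s : ℝ) / d) + (1 - (s : ℝ) / d) =
    (s * (Real.exp ε - 1) + d) / d by field_simp; ring]
  field_simp

theorem mss_eq {d s : ℕ} (hd : 2 ≤ d) {ε : ℝ} (hε : 0 ≤ ε) :
    mss d s ε = (d : ℝ) / (d - 1) * (hMrc ε ((s : ℝ) / d) - (s : ℝ) / d) := by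
  have hd2 : (2 : ℝ) ≤ d := by exact_mod_cast hd
  have hd1 : (d : ℝ) - 1 ≠ 0 := by linarith
  have hd0 : (d : ℝ) ≠ 0 := by linarith
  have hD : (s : ℝ) * (Real.exp ε - 1) + d ≠ 0 := by
    nlinarith [mul_nonneg (Nat.cast_nonneg (α := ℝ) s) (sub_nonneg.mpr (Real.one_le_exp hε))]
  rw [hMrc_natCast_div (by lia), mss]
  field_simp
  ring

theorem bss_eq {d s : ℕ} (hd : 2 ≤ d) {ε : ℝ} (hε : 0 ≤ ε) :
    bss d s ε = 1 / ((d : ℝ) - 1) * (s - hMrc ε ((s : ℝ) / d)) := by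
  have hd2 : (2 : ℝ) ≤ d := by exact_mod_cast hd
  have hd1 : (d : ℝ) - 1 ≠ 0 := by linarith
  have hD : (s : ℝ) * (Real.exp ε - 1) + d ≠ 0 := by
    nlinarith [mul_nonneg (Nat.cast_nonneg (α := ℝ) s) (sub_nonneg.mpr (Real.one_le_exp hε))]
  rw [hMrc_natCast_div (by lia), bss]
  field_simp
  ring

theorem bMrcSS_eq {d s N : ℕ} {ε : ℝ} :
    bMrcSS d s N ε = 1 / ((d : ℝ) - 1) * (s - binomExp N ((s : ℝ) / d) (hMrc ε)) := by
  have total : ∑ M ∈ range (N + 1), (N.choose M : ℝ) * ((s : ℝ) / d) ^ M *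
      (1 - (s : ℝ) / d) ^ (N - M) = 1 := by
    simpa [bernsteinPolynomial, Polynomial.eval_finsetSum] using
      congrArg (Polynomial.eval ((s : ℝ) / d)) (bernsteinPolynomial.sum ℝ N)
  simp only [bMrcSS, binomExp, mul_sub, sum_sub_distrib, ← sum_mul, total, one_mul]

theorem mMrcSS_eq {d s N : ℕ} (hd : 2 ≤ d) {ε : ℝ} :
    mMrcSS d s N ε =
      (d : ℝ) / (d - 1) * (binomExp N ((s : ℝ) / d) (hMrc ε) - (s : ℝ) / d) := by
  have hd2 : (2 : ℝ) ≤ d := by exact_mod_cast hd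
  have hd1 : (d : ℝ) - 1 ≠ 0 := by linarith
  have hd0 : (d : ℝ) ≠ 0 := by linarith
  rw [mMrcSS, bMrcSS_eq]
  field_simp
  ring

/-- **Lemma G.2.**  If `ε ≤ d−1` and `N ≥ 2(e^ε+3)²(1+λ)²/(0.24²λ²)·ln(8(1+λ)/(0.24λ))`,
then `m_ss − m_mrc ≤ λ·m_mrc` and `b_ss ≤ b_mrc`. -/
theorem mrc_ss_scaling_close
    (d : ℕ) (hd : 2 ≤ d) (ε : ℝ) (hε1 : 1 ≤ ε) (hεd : ε ≤ (d : ℝ) - 1)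
    (s : ℕ) (hs : s = ⌈(d : ℝ) / (1 + Real.exp ε)⌉₊)
    (lam : ℝ) (hlam : 0 < lam)
    (N : ℕ) (hN0 : 0 < N)
    (hN : (N : ℝ) ≥ 2 * (Real.exp ε + 3) ^ 2 * (1 + lam) ^ 2 / ((0.24 : ℝ) ^ 2 * lam ^ 2) *
        Real.log (8 * (1 + lam) / ((0.24 : ℝ) * lam))) :
    mss d s ε - mMrcSS d s N ε ≤ lam * mMrcSS d s N ε ∧ bss d s ε ≤ bMrcSS d s N ε := by
  have hε : 0 ≤ ε := by linarith
  have hd2 : (2 : ℝ) ≤ d := by exact_mod_cast hd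
  have hd1 : 0 < (d : ℝ) - 1 := by linarith
  have hsd : s ≤ d := by
    rw [hs, Nat.ceil_le]
    exact div_le_self (by positivity) (by linarith [Real.exp_pos ε])
  have h0 : 0 ≤ (s : ℝ) / d := by positivity
  have h1 : (s : ℝ) / d ≤ 1 :=
    div_le_one_of_le₀ (by exact_mod_cast hsd) (by positivity)
  constructor
  · have key := mul_le_mul_of_nonneg_left (hMrc_sub_le_mul_binomExp_sub hN0 hε h0 h1 hlam
      ((exp_mul_div_le_candidates hlam).trans hN)) (by positivity : 0 ≤ (d : ℝ) / (d - 1))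
    rw [mss_eq hd hε, mMrcSS_eq hd]
    linarith
  · rw [bss_eq hd hε, bMrcSS_eq]
    exact mul_le_mul_of_nonneg_left (sub_le_sub_left (binomExp_hMrc_le hN0 hε h0 h1) _)
      (by positivity)
end
end

section
/- Let d ≥ 1, let x ∈ ℝ^d with ‖x‖₂ ≤ 1, let λ > 0, and let m, m' > 0 with m − m' ≤ λ·m'. Let X̂ and X̂' be random vectors in ℝ^d (on some probability space) with ‖X̂‖₂ = 1/m almost surely and ‖X̂'‖₂ = 1/m' almost surely. Then E[‖X̂' − x‖²] ≤ (1+λ)²·E[‖X̂ − x‖²] + 2(1+λ)(2+λ)·sqrt(E[‖X̂ − x‖²]) + (2+λ)². -/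
open MeasureTheory

/-- The root mean squared distance to `x` of a random vector of constant norm `r` is at least
`r - ‖x‖`. -/
theorem sub_norm_le_sqrt_integral_norm_sub_sq {Ω E : Type*} [MeasurableSpace Ω]
    [NormedAddCommGroup E] (P : Measure Ω) [IsProbabilityMeasure P] {X : Ω → E} {r : ℝ} (x : E)
    (hXmeas : AEStronglyMeasurable X P) (hXnorm : ∀ᵐ ω ∂P, ‖X ω‖ = r) :
    r - ‖x‖ ≤ Real.sqrt (∫ ω, ‖X ω - x‖ ^ 2 ∂P) := by
  rcases le_total (r - ‖x‖) 0 with h | h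
  · exact h.trans (Real.sqrt_nonneg _)
  · apply Real.le_sqrt_of_sq_le
    have hint : Integrable (fun ω => ‖X ω - x‖ ^ 2) P := by
      refine Integrable.of_bound ((hXmeas.sub aestronglyMeasurable_const).norm.pow 2)
        ((r + ‖x‖) ^ 2) ?_
      filter_upwards [hXnorm] with ω hω
      rw [Real.norm_of_nonneg (by positivity), ← hω]
      gcongr
      exact norm_sub_le _ _
    calc (r - ‖x‖) ^ 2 = ∫ _, (r - ‖x‖) ^ 2 ∂P := by simp
      _ ≤ ∫ ω, ‖X ω - x‖ ^ 2 ∂P := by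
        refine integral_mono_ae (integrable_const _) hint ?_
        filter_upwards [hXnorm] with ω hω
        have := norm_sub_norm_le (X ω) x
        rw [hω] at this
        exact pow_le_pow_left₀ h this 2

/-- The mean squared distance to `x` of a random vector of constant norm `r` is at most
`(r + ‖x‖) ^ 2`. -/
theorem integral_norm_sub_sq_le {Ω E : Type*} [MeasurableSpace Ω]
    [NormedAddCommGroup E] (P : Measure Ω) [IsProbabilityMeasure P] {X : Ω → E} {r : ℝ} (x : E)
    (hXnorm : ∀ᵐ ω ∂P, ‖X ω‖ = r) :
    (∫ ω, ‖X ω - x‖ ^ 2 ∂P) ≤ (r + ‖x‖) ^ 2 := by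
  calc (∫ ω, ‖X ω - x‖ ^ 2 ∂P) ≤ ∫ _, (r + ‖x‖) ^ 2 ∂P := by
        refine integral_mono_of_nonneg (.of_forall fun ω => by positivity)
          (integrable_const _) ?_
        filter_upwards [hXnorm] with ω hω
        rw [← hω]
        gcongr
        exact norm_sub_le _ _
    _ = (r + ‖x‖) ^ 2 := by simp

/-- **Propositions F.1 / H.1.**  If `X̂` has constant norm `1/m` a.s., `X̂'` has constant
norm `1/m'` a.s., `‖x‖ ≤ 1` and `m − m' ≤ λ·m'`, then
`E‖X̂' − x‖² ≤ (1+λ)²·E‖X̂ − x‖² + 2(1+λ)(2+λ)·sqrt(E‖X̂ − x‖²) + (2+λ)²`. -/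
theorem mse_close_of_scaling_close
    {Ω : Type*} [MeasurableSpace Ω] (P : Measure Ω) [IsProbabilityMeasure P]
    (d : ℕ) (hd : 1 ≤ d) (x : EuclideanSpace ℝ (Fin d)) (hx : ‖x‖ ≤ 1)
    (lam m m' : ℝ) (hlam : 0 < lam) (hm : 0 < m) (hm' : 0 < m')
    (hmm' : m - m' ≤ lam * m')
    (X X' : Ω → EuclideanSpace ℝ (Fin d))
    (hXmeas : AEStronglyMeasurable X P) (hX'meas : AEStronglyMeasurable X' P)
    (hXnorm : ∀ᵐ ω ∂P, ‖X ω‖ = 1 / m) (hX'norm : ∀ᵐ ω ∂P, ‖X' ω‖ = 1 / m') :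
    (∫ ω, ‖X' ω - x‖ ^ 2 ∂P)
      ≤ (1 + lam) ^ 2 * (∫ ω, ‖X ω - x‖ ^ 2 ∂P)
        + 2 * (1 + lam) * (2 + lam) * Real.sqrt (∫ ω, ‖X ω - x‖ ^ 2 ∂P)
        + (2 + lam) ^ 2 := by
  have hscale : 1 / m' ≤ (1 + lam) * (1 / m) := by
    rw [mul_one_div, div_le_div_iff₀ hm' hm]
    linarith
  have hlow := sub_norm_le_sqrt_integral_norm_sub_sq P x hXmeas hXnorm
  have hup := integral_norm_sub_sq_le P x hX'norm
  have hS : 0 ≤ ∫ ω, ‖X ω - x‖ ^ 2 ∂P := integral_nonneg fun ω => by positivity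
  have hsq := Real.sq_sqrt hS
  set S := ∫ ω, ‖X ω - x‖ ^ 2 ∂P
  have hbound : 1 / m' + ‖x‖ ≤ (1 + lam) * Real.sqrt S + (2 + lam) := by
    have hle : 1 / m ≤ Real.sqrt S + 1 := by linarith
    have := mul_le_mul_of_nonneg_left hle (by linarith : 0 ≤ 1 + lam)
    linarith
  calc (∫ ω, ‖X' ω - x‖ ^ 2 ∂P) ≤ (1 / m' + ‖x‖) ^ 2 := hup
    _ ≤ ((1 + lam) * Real.sqrt S + (2 + lam)) ^ 2 :=
      pow_le_pow_left₀ (by positivity) hbound 2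
    _ = (1 + lam) ^ 2 * Real.sqrt S ^ 2 + 2 * (1 + lam) * (2 + lam) * Real.sqrt S
        + (2 + lam) ^ 2 := by ring
    _ = _ := by rw [hsq]
end

section
/- Let ε ≥ 0, let c1 ≥ c2 > 0 with c1 ≤ e^ε·c2, and let μ ∈ (0,1) with μ·c1 > (1−μ)·c2; set p0 := μ·c1/(μ·c1 + (1−μ)·c2), so p0 > 1/2. Let λ > 0 and let N be a positive integer with N ≥ 2e^{2ε}·(2(1+λ)/(λ(p0 − 1/2)))²·ln(4(1+λ)/(λ(p0 − 1/2))). Let θ := M/N where M ~ Binomial(N, μ), and set p_mrc := E[θ·c1/(θ·c1 + (1−θ)·c2)]. Then p0 − p_mrc ≤ λ·(p0 − 1/2)/(1+λ). -/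
open Real Finset

/-- The odds-reweighted probability `θ c₁ / (θ c₁ + (1 - θ) c₂)` is Lipschitz in `θ` with constant
any bound `K` on the ratio `c₁ / c₂ ≥ 1`. -/
lemma reweighted_sub_le {K c1 c2 x y : ℝ} (hc2 : 0 < c2) (hc12 : c2 ≤ c1) (hK : c1 ≤ K * c2)
    (hx0 : 0 ≤ x) (hy0 : 0 ≤ y) :
    x * c1 / (x * c1 + (1 - x) * c2) - y * c1 / (y * c1 + (1 - y) * c2) ≤ K * |x - y| := by
  have hx : c2 ≤ x * c1 + (1 - x) * c2 := by nlinarith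
  have hy : c2 ≤ y * c1 + (1 - y) * c2 := by nlinarith
  have hprod : c2 * c2 ≤ (x * c1 + (1 - x) * c2) * (y * c1 + (1 - y) * c2) :=
    mul_le_mul hx hy hc2.le (hc2.le.trans hx)
  have hK0 : 0 ≤ K := by
    by_contra! h
    nlinarith
  rw [div_sub_div _ _ (hc2.trans_le hx).ne' (hc2.trans_le hy).ne',
    div_le_iff₀ ((mul_pos hc2 hc2).trans_le hprod)]
  calc x * c1 * (y * c1 + (1 - y) * c2) - (x * c1 + (1 - x) * c2) * (y * c1)
      = c1 * c2 * (x - y) := by ring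
    _ ≤ c1 * c2 * |x - y| :=
        mul_le_mul_of_nonneg_left (le_abs_self _) (mul_nonneg (hc2.le.trans hc12) hc2.le)
    _ ≤ K * c2 * c2 * |x - y| := by gcongr
    _ = K * |x - y| * (c2 * c2) := by ring
    _ ≤ _ := mul_le_mul_of_nonneg_left hprod (mul_nonneg hK0 (abs_nonneg _))

lemma sum_binomial_weights (x : ℝ) (n : ℕ) :
    ∑ k ∈ Finset.range (n + 1), (n.choose k : ℝ) * x ^ k * (1 - x) ^ (n - k) = 1 := by
  have h := (add_pow x (1 - x) n).symm
  rw [add_sub_cancel, one_pow] at h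
  refine Eq.trans ?_ h
  exact Finset.sum_congr rfl fun k _ => by ring

lemma sum_binomial_weights_mul_sq {x : ℝ} (hx0 : 0 ≤ x) (hx1 : x ≤ 1) {n : ℕ} (hn : 0 < n) :
    ∑ k ∈ Finset.range (n + 1), (n.choose k : ℝ) * x ^ k * (1 - x) ^ (n - k) *
      (x - (k : ℝ) / n) ^ 2 = x * (1 - x) / n := by
  have h := bernstein.variance hn.ne' ⟨x, hx0, hx1⟩
  simp only [bernstein_apply, bernstein.z] at h
  rw [← h, Finset.sum_range]
  exact Finset.sum_congr rfl fun k _ => by ring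

/-- **Lemma F.1 (core estimate), MRC simulating PrivUnit₂.**  With `θ = M/N`,
`M ~ Binomial(N, μ)`, and `p_mrc = E[θc1/(θc1+(1−θ)c2)]`, if
`N ≥ 2e^{2ε}·(2(1+λ)/(λ(p0−1/2)))²·ln(4(1+λ)/(λ(p0−1/2)))` then
`p0 − p_mrc ≤ λ(p0−1/2)/(1+λ)`. -/
theorem mrc_privunit_cap_prob_close
    (ε c1 c2 μ : ℝ) (hε : 0 ≤ ε) (hc2 : 0 < c2) (hc12 : c2 ≤ c1)
    (hc1e : c1 ≤ Real.exp ε * c2)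
    (hμ0 : 0 < μ) (hμ1 : μ < 1) (hcap : (1 - μ) * c2 < μ * c1)
    (p0 : ℝ) (hp0 : p0 = μ * c1 / (μ * c1 + (1 - μ) * c2))
    (lam : ℝ) (hlam : 0 < lam)
    (N : ℕ) (hN0 : 0 < N)
    (hN : (N : ℝ) ≥ 2 * Real.exp (2 * ε) *
        (2 * (1 + lam) / (lam * (p0 - 1 / 2))) ^ 2 *
        Real.log (4 * (1 + lam) / (lam * (p0 - 1 / 2)))) :
    p0 - (∑ M ∈ Finset.range (N + 1),
        (N.choose M : ℝ) * μ ^ M * (1 - μ) ^ (N - M) *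
          (((M : ℝ) / (N : ℝ)) * c1 /
            (((M : ℝ) / (N : ℝ)) * c1 + (1 - (M : ℝ) / (N : ℝ)) * c2)))
      ≤ lam * (p0 - 1 / 2) / (1 + lam) := by
  have hden : 0 < μ * c1 + (1 - μ) * c2 := by nlinarith
  have hp_lower : 1 / 2 < p0 := by
    rw [hp0, lt_div_iff₀ hden]
    linarith
  have hp_upper : p0 < 1 := by
    rw [hp0, div_lt_one hden]
    nlinarith
  set D := lam * (p0 - 1 / 2) / (1 + lam) with hD
  have hD0 : 0 < D := div_pos (mul_pos hlam (by linarith)) (by linarith)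
  have hD1 : D < 1 / 2 := by
    rw [hD, div_lt_iff₀ (by linarith)]
    nlinarith
  have hinv (t : ℝ) : t * (1 + lam) / (lam * (p0 - 1 / 2)) = t / D := by
    rw [hD, div_div_eq_mul_div]
  rw [hinv, hinv] at hN
  have hlog : 1 ≤ Real.log (4 / D) := by
    rw [Real.le_log_iff_exp_le (by positivity), le_div_iff₀ hD0]
    nlinarith [Real.exp_one_lt_d9, Real.exp_pos 1]
  set K := Real.exp ε
  have hK : Real.exp (2 * ε) = K ^ 2 := by rw [two_mul, Real.exp_add, sq]
  have hN' : 8 * K ^ 2 ≤ N * D ^ 2 := by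
    have h : 2 * K ^ 2 * (2 / D) ^ 2 ≤ N := by
      rw [hK] at hN
      exact (le_mul_of_one_le_right (by positivity) hlog).trans hN
    calc 8 * K ^ 2 = 2 * K ^ 2 * (2 / D) ^ 2 * D ^ 2 := by field_simp; ring
      _ ≤ N * D ^ 2 := by gcongr
  have hNpos : (0 : ℝ) < N := Nat.cast_pos.mpr hN0
  have hterm (M : ℕ) :
      p0 - (M : ℝ) / N * c1 / ((M : ℝ) / N * c1 + (1 - (M : ℝ) / N) * c2)
        ≤ D / 2 + K ^ 2 / (2 * D) * (μ - (M : ℝ) / N) ^ 2 := by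
    rw [hp0]
    refine (reweighted_sub_le hc2 hc12 hc1e hμ0.le (by positivity)).trans ?_
    rw [← sq_abs (μ - _)]
    generalize |μ - (M : ℝ) / N| = t
    have h : D / 2 + K ^ 2 / (2 * D) * t ^ 2 - K * t = (D - K * t) ^ 2 / (2 * D) := by
      field_simp
      ring
    have : 0 ≤ (D - K * t) ^ 2 / (2 * D) := by positivity
    linarith
  have hw (M : ℕ) : 0 ≤ (N.choose M : ℝ) * μ ^ M * (1 - μ) ^ (N - M) := by
    have := sub_nonneg.mpr hμ1.le
    positivity
  have hvar : K ^ 2 / (2 * D) * (μ * (1 - μ) / N) ≤ D / 2 := by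
    have hμ : μ * (1 - μ) ≤ 1 := by nlinarith
    rw [div_mul_div_comm, div_le_iff₀ (by positivity)]
    nlinarith [sq_nonneg K, mul_le_mul_of_nonneg_left hμ (sq_nonneg K)]
  calc p0 - _ = ∑ M ∈ Finset.range (N + 1),
        (N.choose M : ℝ) * μ ^ M * (1 - μ) ^ (N - M) *
          (p0 - (M : ℝ) / N * c1 / ((M : ℝ) / N * c1 + (1 - (M : ℝ) / N) * c2)) := by
        simp only [mul_sub, Finset.sum_sub_distrib, ← Finset.sum_mul, sum_binomial_weights, one_mul]
    _ ≤ ∑ M ∈ Finset.range (N + 1), (N.choose M : ℝ) * μ ^ M * (1 - μ) ^ (N - M) *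
          (D / 2 + K ^ 2 / (2 * D) * (μ - (M : ℝ) / N) ^ 2) :=
        Finset.sum_le_sum fun M _ => mul_le_mul_of_nonneg_left (hterm M) (hw M)
    _ = D / 2 + K ^ 2 / (2 * D) * (μ * (1 - μ) / N) := by
        rw [← sum_binomial_weights_mul_sq hμ0.le hμ1.le hN0, Finset.mul_sum]
        simp only [mul_add, Finset.sum_add_distrib, ← Finset.sum_mul, sum_binomial_weights, one_mul]
        exact congrArg _ (Finset.sum_congr rfl fun M _ => by ring)
    _ ≤ D := by linarith
end
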